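/- Let d ≥ 1, n₁,…,n_d ≥ 1, n = n₁+…+n_d. There exist constants C, A > 0 depending only on n₁,…,n_d such that for every measurable set E ⊂ ℝⁿ with 0 < |E| < ∞ there exists a measurable function m : ℝⁿ → (0, 1] satisfying: m = 1 almost everywhere on E; ‖m‖_{L²} ≤ C|E|^{1/2}; and M_s m(x) ≤ A·m(x) for almost every x ∈ ℝⁿ (i.e., m is a strong-maximal A₁ weight). -/

import Mathlib

open MeasureTheory ENNReal Filter

noncomputable section

/-- A dyadic cube in `ℝ^m`, recorded by its generation `k` and its corner index `j`;
it represents the set `∏ i, [j i * 2^k, (j i + 1) * 2^k)`. -/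
structure DyadicCube (m : ℕ) where
  k : ℤ
  j : Fin m → ℤ

/-- The underlying set of a dyadic cube. -/
def dyadicCubeSet {m : ℕ} (c : DyadicCube m) : Set (Fin m → ℝ) :=
  {x | ∀ i, (c.j i : ℝ) * 2 ^ c.k ≤ x i ∧ x i < ((c.j i : ℝ) + 1) * 2 ^ c.k}

/-- The generation-`k` dyadic cube containing the point `x`. -/
def dyadicCubeOf {m : ℕ} (k : ℤ) (x : Fin m → ℝ) : DyadicCube m :=
  ⟨k, fun i => ⌊x i / 2 ^ k⌋⟩

/-- `E_k f x`: the average of `f` over the generation-`k` dyadic cube containing `x`. -/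
def Ek {m : ℕ} (k : ℤ) (f : (Fin m → ℝ) → ℝ) (x : Fin m → ℝ) : ℝ :=
  ⨍ y in dyadicCubeSet (dyadicCubeOf k x), f y

/-- The martingale difference operator `Δ_Q f = (E_{k-1} f - E_k f) · 1_Q`
for a dyadic cube `Q` of generation `k`. -/
def deltaQ {m : ℕ} (c : DyadicCube m) (f : (Fin m → ℝ) → ℝ) : (Fin m → ℝ) → ℝ :=
  (dyadicCubeSet c).indicator (fun y => Ek (c.k - 1) f y - Ek c.k f y)

/-- The product space `ℝ^{n 0} × ⋯ × ℝ^{n (d-1)}`. -/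
abbrev ProductSpace {d : ℕ} (n : Fin d → ℕ) : Type := ∀ i, (Fin (n i) → ℝ)

/-- A dyadic rectangle `R = Q₁ × ⋯ × Q_d`, one dyadic cube in each block. -/
abbrev DyadicRect {d : ℕ} (n : Fin d → ℕ) : Type := ∀ i, DyadicCube (n i)

/-- The underlying set of a dyadic rectangle. -/
def dyadicRectSet {d : ℕ} {n : Fin d → ℕ} (R : DyadicRect n) : Set (ProductSpace n) :=
  {x | ∀ i, x i ∈ dyadicCubeSet (R i)}

/-- Apply the one-parameter operator `Δ_Q` in the `i`-th block of variables. -/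
def deltaBlock {d : ℕ} {n : Fin d → ℕ} (i : Fin d) (c : DyadicCube (n i))
    (f : ProductSpace n → ℝ) (x : ProductSpace n) : ℝ :=
  deltaQ c (fun y => f (Function.update x i y)) (x i)

/-- The multiparameter difference operator `Δ_R = Δ_{Q₁} ⊗ ⋯ ⊗ Δ_{Q_d}`, obtained
by applying `Δ_{Q_i}` in the `i`-th block of variables. -/
def deltaR {d : ℕ} {n : Fin d → ℕ} (R : DyadicRect n) (f : ProductSpace n → ℝ) :
    ProductSpace n → ℝ :=
  (List.finRange d).foldr (fun i g => deltaBlock i (R i) g) f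

/-- The squared `L²` norm `‖g‖_{L²}²`, as an extended nonnegative real. -/
def l2normSq {d : ℕ} {n : Fin d → ℕ} (g : ProductSpace n → ℝ) : ℝ≥0∞ :=
  ∫⁻ x, ENNReal.ofReal (g x ^ 2)

/-- The multiparameter dyadic square function `S f (x) = (∑_R |Δ_R f(x)|²)^{1/2}`. -/
def squareFn {d : ℕ} {n : Fin d → ℕ} (f : ProductSpace n → ℝ) (x : ProductSpace n) : ℝ≥0∞ :=
  (∑' R : DyadicRect n, ENNReal.ofReal (deltaR R f x ^ 2)) ^ (1 / 2 : ℝ)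

/-- The dyadic product `H¹` norm `‖S f‖_{L¹}`. -/
def H1Norm {d : ℕ} {n : Fin d → ℕ} (f : ProductSpace n → ℝ) : ℝ≥0∞ :=
  ∫⁻ x, squareFn f x

/-- An axis-parallel cube in `ℝ^m` with arbitrary corner and (positive) side length. -/
structure Cube (m : ℕ) where
  corner : Fin m → ℝ
  side : ℝ
  side_pos : 0 < side

/-- The underlying set of a cube. -/
def cubeSet {m : ℕ} (c : Cube m) : Set (Fin m → ℝ) :=
  {x | ∀ i, c.corner i ≤ x i ∧ x i < c.corner i + c.side}

/-- A rectangle `R = Q₁ × ⋯ × Q_d`: an axis-parallel cube in each block. -/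
abbrev Rect {d : ℕ} (n : Fin d → ℕ) : Type := ∀ i, Cube (n i)

/-- The underlying set of a rectangle. -/
def rectSet {d : ℕ} {n : Fin d → ℕ} (R : Rect n) : Set (ProductSpace n) :=
  {x | ∀ i, x i ∈ cubeSet (R i)}

/-- The little `bmo` norm: `sup_R |R|⁻¹ ∫_R |f - f_R|` over all rectangles. -/
def bmo1 {d : ℕ} {n : Fin d → ℕ} (f : ProductSpace n → ℝ) : ℝ≥0∞ :=
  ⨆ R : Rect n,
    (volume (rectSet R))⁻¹ * ∫⁻ x in rectSet R, ENNReal.ofReal |f x - ⨍ y in rectSet R, f y|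

/-- The `L²`-based little `bmo` norm: `sup_R (|R|⁻¹ ∫_R |f - f_R|²)^{1/2}` over all
rectangles. -/
def bmo2 {d : ℕ} {n : Fin d → ℕ} (f : ProductSpace n → ℝ) : ℝ≥0∞ :=
  ⨆ R : Rect n,
    ((volume (rectSet R))⁻¹ *
      ∫⁻ x in rectSet R, ENNReal.ofReal ((f x - ⨍ y in rectSet R, f y) ^ 2)) ^ (1 / 2 : ℝ)

/-- The one-parameter `BMO` norm over all axis-parallel cubes in `ℝ^m`. -/
def bmo1Cube {m : ℕ} (g : (Fin m → ℝ) → ℝ) : ℝ≥0∞ :=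
  ⨆ Q : Cube m,
    (volume (cubeSet Q))⁻¹ * ∫⁻ x in cubeSet Q, ENNReal.ofReal |g x - ⨍ y in cubeSet Q, g y|

/-- The `L²`-based one-parameter `BMO` norm over all axis-parallel cubes in `ℝ^m`. -/
def bmo2Cube {m : ℕ} (g : (Fin m → ℝ) → ℝ) : ℝ≥0∞ :=
  ⨆ Q : Cube m,
    ((volume (cubeSet Q))⁻¹ *
      ∫⁻ x in cubeSet Q, ENNReal.ofReal ((g x - ⨍ y in cubeSet Q, g y) ^ 2)) ^ (1 / 2 : ℝ)

/-- The strong maximal function: supremum of averages of `|f|` over all rectangles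
containing the point. -/
def strongMaximal {d : ℕ} {n : Fin d → ℕ} (f : ProductSpace n → ℝ) (x : ProductSpace n) :
    ℝ≥0∞ :=
  ⨆ (R : Rect n) (_ : x ∈ rectSet R),
    (volume (rectSet R))⁻¹ * ∫⁻ y in rectSet R, ENNReal.ofReal |f y|

end

/-- The dyadic-radius centred maximal function on `ℝ^m` with the sup norm. -/
noncomputable def ballMax {m : ℕ} (g : (Fin m → ℝ) → ℝ≥0∞) (x : Fin m → ℝ) : ℝ≥0∞ :=
  ⨆ k : ℤ, (volume (Metric.closedBall x (2 ^ k)))⁻¹ *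
    ∫⁻ y in Metric.closedBall x (2 ^ k), g y

lemma volume_closedBall_mul {m : ℕ} (x y : Fin m → ℝ) {c r : ℝ} (hc : 0 ≤ c) (hr : 0 ≤ r) :
    volume (Metric.closedBall x (c * r)) =
      ENNReal.ofReal (c ^ m) * volume (Metric.closedBall y r) := by
  rw [Real.volume_pi_closedBall _ (mul_nonneg hc hr), Real.volume_pi_closedBall _ hr,
    ← ENNReal.ofReal_mul (by positivity), Fintype.card_fin]
  congr 1
  rw [← mul_pow]
  ring

lemma volume_closedBall_ne_zero {m : ℕ} (x : Fin m → ℝ) {r : ℝ} (hr : 0 < r) :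
    volume (Metric.closedBall x r) ≠ 0 :=
  (Metric.measure_closedBall_pos volume x hr).ne'

lemma volume_closedBall_ne_top {m : ℕ} (x : Fin m → ℝ) (r : ℝ) :
    volume (Metric.closedBall x r) ≠ ⊤ :=
  measure_closedBall_lt_top.ne

lemma measure_biUnion_closedBall_le {m : ℕ} (g : (Fin m → ℝ) → ℝ≥0∞) (t : ℝ≥0∞)
    (S : Set (Fin m → ℝ)) (r : (Fin m → ℝ) → ℝ) (R : ℝ) (hr : ∀ a ∈ S, 0 < r a)
    (hR : ∀ a ∈ S, r a ≤ R)
    (hS : ∀ a ∈ S, t * volume (Metric.closedBall a (r a)) ≤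
      ∫⁻ y in Metric.closedBall a (r a), g y) :
    t * volume S ≤ ENNReal.ofReal (5 ^ m) * ∫⁻ y, g y := by
  obtain ⟨u, huS, hdisj, hcov⟩ := Vitali.exists_disjoint_subfamily_covering_enlargement_closedBall
    S id r R hR 5 (by norm_num)
  simp only [id] at hdisj hcov
  have hcount : u.Countable := hdisj.countable_of_nonempty_interior fun a ha =>
    ⟨a, Metric.ball_subset_interior_closedBall (Metric.mem_ball_self (hr a (huS ha)))⟩
  have hsub : S ⊆ ⋃ a ∈ u, Metric.closedBall a (5 * r a) := fun a ha => by
    obtain ⟨b, hb, hab⟩ := hcov a ha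
    exact Set.mem_biUnion hb (hab (Metric.mem_closedBall_self (hr a ha).le))
  have hvol : volume S ≤
      ∑' a : u, ENNReal.ofReal (5 ^ m) * volume (Metric.closedBall (a : Fin m → ℝ) (r a)) := by
    refine (measure_mono hsub).trans ((measure_biUnion_le _ hcount _).trans (le_of_eq ?_))
    exact tsum_congr fun a => volume_closedBall_mul _ _ (by norm_num) (hr a (huS a.2)).le
  calc t * volume S
      ≤ t * ∑' a : u, ENNReal.ofReal (5 ^ m) *
          volume (Metric.closedBall (a : Fin m → ℝ) (r a)) := by gcongr
    _ = ENNReal.ofReal (5 ^ m) *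
          ∑' a : u, t * volume (Metric.closedBall (a : Fin m → ℝ) (r a)) := by
        rw [ENNReal.tsum_mul_left, ENNReal.tsum_mul_left, mul_left_comm]
    _ ≤ ENNReal.ofReal (5 ^ m) *
          ∑' a : u, ∫⁻ y in Metric.closedBall (a : Fin m → ℝ) (r a), g y := by
        gcongr with a
        exact hS a (huS a.2)
    _ = ENNReal.ofReal (5 ^ m) * ∫⁻ y in ⋃ a ∈ u, Metric.closedBall a (r a), g y := by
        rw [lintegral_biUnion hcount (fun _ _ => Metric.isClosed_closedBall.measurableSet) hdisj]
    _ ≤ ENNReal.ofReal (5 ^ m) * ∫⁻ y, g y := by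
        gcongr
        exact Measure.restrict_le_self

/-- The weak-type `(1,1)` inequality for `ballMax`. -/
lemma mul_meas_lt_ballMax_le {m : ℕ} (g : (Fin m → ℝ) → ℝ≥0∞) (t : ℝ≥0∞) :
    t * volume {x | t < ballMax g x} ≤ ENNReal.ofReal (5 ^ m) * ∫⁻ y, g y := by
  let S : ℕ → Set (Fin m → ℝ) := fun N => {x | ∃ k : ℤ, k ≤ N ∧
    t < (volume (Metric.closedBall x (2 ^ k)))⁻¹ * ∫⁻ y in Metric.closedBall x (2 ^ k), g y}
  have hmono : Monotone S := fun N N' hN x ⟨k, hk, hx⟩ => ⟨k, hk.trans (by exact_mod_cast hN), hx⟩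
  have hU : {x | t < ballMax g x} = ⋃ N, S N := by
    ext x
    simp only [Set.mem_ofPred_eq, ballMax, lt_iSup_iff, Set.mem_iUnion, S]
    constructor
    · rintro ⟨k, hk⟩
      exact ⟨k.toNat, k, Int.self_le_toNat k, hk⟩
    · rintro ⟨N, k, -, hk⟩
      exact ⟨k, hk⟩
  rw [hU, hmono.measure_iUnion, ENNReal.mul_iSup]
  refine iSup_le fun N => ?_
  have hch : ∀ x, ∃ k : ℤ, x ∈ S N → k ≤ N ∧
      t < (volume (Metric.closedBall x (2 ^ k)))⁻¹ * ∫⁻ y in Metric.closedBall x (2 ^ k), g y := by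
    intro x
    by_cases hx : x ∈ S N
    · obtain ⟨k, hk⟩ := hx
      exact ⟨k, fun _ => hk⟩
    · exact ⟨0, fun h => absurd h hx⟩
  choose κ hκ using hch
  refine measure_biUnion_closedBall_le g t (S N) (fun x => 2 ^ κ x) (2 ^ (N : ℤ))
    (fun a _ => by positivity)
    (fun a ha => zpow_le_zpow_right₀ (by norm_num) (hκ a ha).1) fun a ha => ?_
  have h0 := volume_closedBall_ne_zero a (r := 2 ^ κ a) (by positivity)
  have h1 := volume_closedBall_ne_top a (2 ^ κ a)
  have := (hκ a ha).2.le
  rw [← ENNReal.div_eq_inv_mul, ENNReal.le_div_iff_mul_le (Or.inl h0) (Or.inl h1)] at this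
  exact this

lemma ballMax_le_add {m : ℕ} {g h : (Fin m → ℝ) → ℝ≥0∞} (s : ℝ≥0∞)
    (hgh : ∀ y, g y ≤ h y + s) (x : Fin m → ℝ) :
    ballMax g x ≤ ballMax h x + s := by
  refine iSup_le fun k => ?_
  have h0 := volume_closedBall_ne_zero x (r := 2 ^ k) (by positivity)
  have h1 := volume_closedBall_ne_top x (2 ^ k)
  calc (volume (Metric.closedBall x (2 ^ k)))⁻¹ * ∫⁻ y in Metric.closedBall x (2 ^ k), g y
      ≤ (volume (Metric.closedBall x (2 ^ k)))⁻¹ *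
          ∫⁻ y in Metric.closedBall x (2 ^ k), (h y + s) := by
        gcongr with y
        exact hgh y
    _ = (volume (Metric.closedBall x (2 ^ k)))⁻¹ * (∫⁻ y in Metric.closedBall x (2 ^ k), h y) +
          s := by
        rw [lintegral_add_right _ measurable_const, mul_add, setLIntegral_const, mul_comm s,
          ← mul_assoc, ENNReal.inv_mul_cancel h0 h1, one_mul]
    _ ≤ ballMax h x + s := by
        gcongr
        exact le_iSup (fun k : ℤ => (volume (Metric.closedBall x (2 ^ k)))⁻¹ *
          ∫⁻ y in Metric.closedBall x (2 ^ k), h y) k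

lemma measurable_setLIntegral_closedBall {α : Type*} [MeasurableSpace α] {m : ℕ}
    {c : α → Fin m → ℝ} (hc : Measurable c) {F : α → (Fin m → ℝ) → ℝ≥0∞}
    (hF : Measurable (Function.uncurry F)) (r : ℝ) :
    Measurable fun a => ∫⁻ y in Metric.closedBall (c a) r, F a y := by
  have hset : MeasurableSet {p : α × (Fin m → ℝ) | dist p.2 (c p.1) ≤ r} :=
    measurableSet_le (measurable_snd.dist (hc.comp measurable_fst)) measurable_const
  have h := (hF.indicator hset).lintegral_prod_right' (ν := (volume : Measure (Fin m → ℝ)))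
  convert h using 2 with a
  rw [← lintegral_indicator Metric.isClosed_closedBall.measurableSet]
  rfl

lemma measurable_ballMax_param {α : Type*} [MeasurableSpace α] {m : ℕ}
    {c : α → Fin m → ℝ} (hc : Measurable c) {F : α → (Fin m → ℝ) → ℝ≥0∞}
    (hF : Measurable (Function.uncurry F)) :
    Measurable fun a => ballMax (F a) (c a) := by
  refine Measurable.iSup fun k => ?_
  have : (fun a => (volume (Metric.closedBall (c a) (2 ^ k)))⁻¹ *
      ∫⁻ y in Metric.closedBall (c a) (2 ^ k), F a y) =
      fun a => (volume (Metric.closedBall (0 : Fin m → ℝ) (2 ^ k)))⁻¹ *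
      ∫⁻ y in Metric.closedBall (c a) (2 ^ k), F a y := by
    ext a
    rw [Real.volume_pi_closedBall _ (by positivity), Real.volume_pi_closedBall _ (by positivity)]
  rw [this]
  exact (measurable_setLIntegral_closedBall hc hF _).const_mul _

lemma sq_le_lintegral_ofReal (a : ℝ≥0∞) :
    a ^ 2 ≤ 4 * ∫⁻ t : ℝ, (Set.Ioi (0 : ℝ)).indicator
      (fun t => ENNReal.ofReal t * {t : ℝ | ENNReal.ofReal t < a}.indicator 1 t) t := by
  set I := ∫⁻ t : ℝ, (Set.Ioi (0 : ℝ)).indicator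
      (fun t => ENNReal.ofReal t * {t : ℝ | ENNReal.ofReal t < a}.indicator 1 t) t with hI
  have key : ∀ c : NNReal, (c : ℝ≥0∞) ≤ a → (c : ℝ≥0∞) ^ 2 ≤ 4 * I := by
    intro c hc
    have h1 : ∫⁻ t : ℝ, (Set.Ioo (c / 2 : ℝ) c).indicator
        (fun _ => ENNReal.ofReal (c / 2)) t ≤ I := by
      refine lintegral_mono fun t => ?_
      by_cases ht : t ∈ Set.Ioo (c / 2 : ℝ) c
      · have h0 : (0 : ℝ) < t := lt_of_le_of_lt (by positivity) ht.1
        have hlt : ENNReal.ofReal t < a := by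
          refine lt_of_lt_of_le ?_ hc
          rw [← ENNReal.ofReal_coe_nnreal]
          exact (ENNReal.ofReal_lt_ofReal_iff (h0.trans ht.2)).2 ht.2
        rw [Set.indicator_of_mem ht, Set.indicator_of_mem (Set.mem_Ioi.2 h0),
          Set.indicator_of_mem (show t ∈ {t : ℝ | ENNReal.ofReal t < a} from hlt)]
        simpa using ENNReal.ofReal_le_ofReal ht.1.le
      · rw [Set.indicator_of_notMem ht]
        exact zero_le
    rw [lintegral_indicator measurableSet_Ioo, setLIntegral_const, Real.volume_Ioo] at h1
    refine le_trans (le_of_eq ?_) (mul_le_mul_right h1 4)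
    rw [← ENNReal.ofReal_mul (by positivity), ← ENNReal.ofReal_coe_nnreal,
      ← ENNReal.ofReal_pow c.coe_nonneg, show (4 : ℝ≥0∞) = ENNReal.ofReal 4 by norm_num,
      ← ENNReal.ofReal_mul (by norm_num)]
    congr 1
    ring
  by_cases ha : a = ⊤
  · have : 4 * I = ⊤ := by
      refine ENNReal.eq_top_of_forall_nnreal_le fun r => ?_
      refine le_trans ?_ (key (r + 1) (by simp [ha]))
      have : r ≤ (r + 1) ^ 2 := by nlinarith [r.2, sq_nonneg (r : ℝ)]
      exact_mod_cast this
    rw [this]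
    exact le_top
  · lift a to NNReal using ha
    exact key a le_rfl

lemma lintegral_indicator_lt_le (b : ℝ≥0∞) :
    ∫⁻ t : ℝ, (Set.Ioi (0 : ℝ)).indicator
      (fun t => {t : ℝ | ENNReal.ofReal t / 2 < b}.indicator 1 t) t ≤ 2 * b := by
  by_cases hb : b = ⊤
  · simp [hb]
  lift b to NNReal using hb
  calc _ ≤ ∫⁻ t : ℝ, (Set.Ioo (0 : ℝ) (2 * b)).indicator 1 t := by
        refine lintegral_mono fun t => ?_
        by_cases h0 : t ∈ Set.Ioi (0 : ℝ)
        · rw [Set.indicator_of_mem h0]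
          by_cases ht : ENNReal.ofReal t / 2 < b
          · rw [Set.indicator_of_mem (show t ∈ Set.Ioo (0 : ℝ) (2 * b) from ⟨h0, ?_⟩)]
            · exact Set.indicator_le_self' (fun _ _ => zero_le) _
            · have := ENNReal.lt_ofReal_iff_toReal_lt (b := (b : ℝ))
                (ne_top_of_lt ht) |>.1 (by simpa using ht)
              rw [ENNReal.toReal_div, ENNReal.toReal_ofReal (le_of_lt h0)] at this
              simp at this
              linarith
          · rw [Set.indicator_of_notMem (by simpa using ht)]
            exact zero_le
        · rw [Set.indicator_of_notMem h0]
          exact zero_le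
    _ = 2 * b := by
        rw [lintegral_indicator_one measurableSet_Ioo, Real.volume_Ioo, sub_zero,
          ENNReal.ofReal_mul (by norm_num)]
        simp

/-- The `L²` inequality for `ballMax`. -/
lemma lintegral_ballMax_sq_le {m : ℕ} {g : (Fin m → ℝ) → ℝ≥0∞} (hg : Measurable g) :
    ∫⁻ x, ballMax g x ^ 2 ≤ ENNReal.ofReal (16 * 5 ^ m) * ∫⁻ x, g x ^ 2 := by
  have hM : Measurable (ballMax g) := by
    have := measurable_ballMax_param (c := id) (F := fun _ : Fin m → ℝ => g) measurable_id
      (hg.comp measurable_snd)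
    exact this
  have hmt : Measurable fun t : ℝ => ENNReal.ofReal t := ENNReal.measurable_ofReal
  have hlevel : ∀ t : ℝ, ENNReal.ofReal t * volume {x | ENNReal.ofReal t < ballMax g x} ≤
      2 * ENNReal.ofReal (5 ^ m) *
        ∫⁻ y, g y * {t : ℝ | ENNReal.ofReal t / 2 < g y}.indicator 1 t := by
    intro t
    set τ := ENNReal.ofReal t
    let h : (Fin m → ℝ) → ℝ≥0∞ := fun y => g y * {t : ℝ | ENNReal.ofReal t / 2 < g y}.indicator 1 t
    have hsub : {x | τ < ballMax g x} ⊆ {x | τ / 2 < ballMax h x} := by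
      intro x hx
      by_contra hcon
      have hx' : ballMax h x ≤ τ / 2 := not_lt.1 hcon
      have := ballMax_le_add (g := g) (h := h) (τ / 2) (fun y => ?_) x
      · have h2 : ballMax g x ≤ τ := this.trans ((add_le_add_left hx' _).trans
          (ENNReal.add_halves τ).le)
        exact absurd hx (not_lt.2 h2)
      · by_cases hy : τ / 2 < g y
        · simp only [h]
          rw [Set.indicator_of_mem (by exact hy)]
          simp
        · exact (not_lt.1 hy).trans le_add_self
    calc τ * volume {x | τ < ballMax g x}
        ≤ τ * volume {x | τ / 2 < ballMax h x} := by gcongr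
      _ = 2 * (τ / 2 * volume {x | τ / 2 < ballMax h x}) := by
          rw [← mul_assoc, ENNReal.mul_div_cancel (by norm_num) (by norm_num)]
      _ ≤ 2 * (ENNReal.ofReal (5 ^ m) * ∫⁻ y, h y) :=
          mul_le_mul_right (mul_meas_lt_ballMax_le h (τ / 2)) 2
      _ = _ := by rw [mul_assoc]
  have hjoint1 : Measurable (Function.uncurry fun (x : Fin m → ℝ) (t : ℝ) =>
      (Set.Ioi (0 : ℝ)).indicator (fun t => ENNReal.ofReal t *
        {t : ℝ | ENNReal.ofReal t < ballMax g x}.indicator 1 t) t) := by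
    have hs : MeasurableSet {p : (Fin m → ℝ) × ℝ | ENNReal.ofReal p.2 < ballMax g p.1} :=
      measurableSet_lt (hmt.comp measurable_snd) (hM.comp measurable_fst)
    have := (((hmt.comp measurable_snd).mul ((measurable_const (a := (1 : ℝ≥0∞))).indicator hs)
      )).indicator ((measurable_snd : Measurable (Prod.snd : (Fin m → ℝ) × ℝ → ℝ))
        (measurableSet_Ioi (a := (0 : ℝ))))
    exact this
  have hjoint2 : Measurable (Function.uncurry fun (t : ℝ) (y : Fin m → ℝ) =>
      (Set.Ioi (0 : ℝ)).indicator (fun t => g y *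
        {t : ℝ | ENNReal.ofReal t / 2 < g y}.indicator 1 t) t) := by
    have hs : MeasurableSet {p : ℝ × (Fin m → ℝ) | ENNReal.ofReal p.1 / 2 < g p.2} :=
      measurableSet_lt ((hmt.comp measurable_fst).div_const 2) (hg.comp measurable_snd)
    have := (((hg.comp measurable_snd).mul ((measurable_const (a := (1 : ℝ≥0∞))).indicator hs)
      )).indicator ((measurable_fst : Measurable (Prod.fst : ℝ × (Fin m → ℝ) → ℝ))
        (measurableSet_Ioi (a := (0 : ℝ))))
    exact this
  calc ∫⁻ x, ballMax g x ^ 2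
      ≤ ∫⁻ x, 4 * ∫⁻ t : ℝ, (Set.Ioi (0 : ℝ)).indicator (fun t => ENNReal.ofReal t *
          {t : ℝ | ENNReal.ofReal t < ballMax g x}.indicator 1 t) t :=
        lintegral_mono fun x => sq_le_lintegral_ofReal _
    _ = 4 * ∫⁻ t : ℝ, ∫⁻ x, (Set.Ioi (0 : ℝ)).indicator (fun t => ENNReal.ofReal t *
          {t : ℝ | ENNReal.ofReal t < ballMax g x}.indicator 1 t) t := by
        rw [lintegral_const_mul' _ _ (by norm_num), lintegral_lintegral_swap hjoint1.aemeasurable]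
    _ ≤ 4 * ∫⁻ t : ℝ, 2 * ENNReal.ofReal (5 ^ m) * ∫⁻ y, (Set.Ioi (0 : ℝ)).indicator (fun t =>
          g y * {t : ℝ | ENNReal.ofReal t / 2 < g y}.indicator 1 t) t := by
        gcongr with t
        by_cases ht : t ∈ Set.Ioi (0 : ℝ)
        · simp only [Set.indicator_of_mem ht]
          refine le_trans (le_of_eq ?_) (hlevel t)
          rw [lintegral_const_mul' _ _ ENNReal.ofReal_ne_top,
            ← lintegral_indicator_one (measurableSet_lt measurable_const hM)]
          rfl
        · simp [Set.indicator_of_notMem ht]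
    _ = 4 * (2 * ENNReal.ofReal (5 ^ m)) * ∫⁻ y, g y * ∫⁻ t : ℝ, (Set.Ioi (0 : ℝ)).indicator
          (fun t => {t : ℝ | ENNReal.ofReal t / 2 < g y}.indicator 1 t) t := by
        rw [lintegral_const_mul' _ _ (ENNReal.mul_ne_top (by norm_num) ENNReal.ofReal_ne_top),
          lintegral_lintegral_swap hjoint2.aemeasurable, ← mul_assoc]
        congr 2
        ext y
        rw [← lintegral_const_mul]
        · congr 1
          ext t
          by_cases ht : t ∈ Set.Ioi (0 : ℝ)
          · simp only [Set.indicator_of_mem ht]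
          · simp [Set.indicator_of_notMem ht]
        · exact ((measurable_const (a := (1 : ℝ≥0∞))).indicator
            (measurableSet_lt (hmt.div_const 2) measurable_const)).indicator measurableSet_Ioi
    _ ≤ 4 * (2 * ENNReal.ofReal (5 ^ m)) * ∫⁻ y, g y * (2 * g y) := by
        gcongr with y
        exact lintegral_indicator_lt_le _
    _ = _ := by
        have : ∀ y, g y * (2 * g y) = 2 * g y ^ 2 := fun y => by ring
        simp_rw [this]
        rw [lintegral_const_mul' _ _ (by norm_num), ← mul_assoc,
          ENNReal.ofReal_mul (by norm_num), show ENNReal.ofReal 16 = 16 by norm_num]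
        congr 1
        ring

lemma ballMax_mono {m : ℕ} {g h : (Fin m → ℝ) → ℝ≥0∞} (hgh : ∀ y, g y ≤ h y)
    (x : Fin m → ℝ) : ballMax g x ≤ ballMax h x := by
  simpa using ballMax_le_add (g := g) (h := h) 0 (by simpa using hgh) x

lemma ballMax_tsum_le {m : ℕ} (c : ℕ → ℝ≥0∞) {g : ℕ → (Fin m → ℝ) → ℝ≥0∞}
    (hg : ∀ k, Measurable (g k)) (x : Fin m → ℝ) :
    ballMax (fun y => ∑' k, c k * g k y) x ≤ ∑' k, c k * ballMax (g k) x := by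
  refine iSup_le fun l => ?_
  rw [lintegral_tsum fun k => ((hg k).const_mul (c k)).aemeasurable, ← ENNReal.tsum_mul_left]
  refine ENNReal.tsum_le_tsum fun k => ?_
  rw [lintegral_const_mul _ (hg k), mul_left_comm]
  gcongr
  exact le_iSup (fun l : ℤ => (volume (Metric.closedBall x (2 ^ l)))⁻¹ *
    ∫⁻ y in Metric.closedBall x (2 ^ l), g k y) l

lemma cubeSet_eq_pi {m : ℕ} (c : Cube m) :
    cubeSet c = Set.univ.pi fun i => Set.Ico (c.corner i) (c.corner i + c.side) := by
  ext x
  simp [cubeSet, Set.mem_pi]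

lemma measurableSet_cubeSet {m : ℕ} (c : Cube m) : MeasurableSet (cubeSet c) := by
  rw [cubeSet_eq_pi]
  exact MeasurableSet.univ_pi fun _ => measurableSet_Ico

lemma volume_cubeSet {m : ℕ} (c : Cube m) :
    volume (cubeSet c) = ENNReal.ofReal (c.side ^ m) := by
  rw [cubeSet_eq_pi, volume_pi_pi]
  simp [Real.volume_Ico, ENNReal.ofReal_pow c.side_pos.le]

lemma setLIntegral_cubeSet_le {m : ℕ} (g : (Fin m → ℝ) → ℝ≥0∞) (c : Cube m)
    {x : Fin m → ℝ} (hx : x ∈ cubeSet c) :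
    ∫⁻ y in cubeSet c, g y ≤ ENNReal.ofReal (4 ^ m) * volume (cubeSet c) * ballMax g x := by
  obtain ⟨k, hk1, hk2⟩ := exists_mem_Ico_zpow c.side_pos (one_lt_two (α := ℝ))
  have hk3 : (2 : ℝ) ^ (k + 1) ≤ 2 * c.side := by
    rw [zpow_add_one₀ (by norm_num)]
    linarith
  have hsub : cubeSet c ⊆ Metric.closedBall x (2 ^ (k + 1)) := fun y hy => by
    rw [Metric.mem_closedBall, dist_pi_le_iff (by positivity)]
    intro i
    have h1 := hx i
    have h2 := hy i
    rw [Real.dist_eq, abs_le]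
    constructor <;> linarith [h1.1, h1.2, h2.1, h2.2]
  have h0 := volume_closedBall_ne_zero x (r := 2 ^ (k + 1)) (by positivity)
  have h1 := volume_closedBall_ne_top x (2 ^ (k + 1))
  calc ∫⁻ y in cubeSet c, g y
      ≤ ∫⁻ y in Metric.closedBall x (2 ^ (k + 1)), g y := lintegral_mono_set hsub
    _ = volume (Metric.closedBall x (2 ^ (k + 1))) *
          ((volume (Metric.closedBall x (2 ^ (k + 1))))⁻¹ *
            ∫⁻ y in Metric.closedBall x (2 ^ (k + 1)), g y) := by
        rw [← mul_assoc, ENNReal.mul_inv_cancel h0 h1, one_mul]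
    _ ≤ ENNReal.ofReal (4 ^ m) * volume (cubeSet c) * ballMax g x := by
        gcongr
        · rw [Real.volume_pi_closedBall _ (by positivity), volume_cubeSet,
            ← ENNReal.ofReal_mul (by positivity), ← mul_pow, Fintype.card_fin]
          exact ENNReal.ofReal_le_ofReal
            (pow_le_pow_left₀ (by positivity) (by linarith) m)
        · exact le_iSup (fun l : ℤ => (volume (Metric.closedBall x (2 ^ l)))⁻¹ *
            ∫⁻ y in Metric.closedBall x (2 ^ l), g y) (k + 1)

/-- `ballMax` acting in the `i`-th block of variables. -/
noncomputable def blockMax {d : ℕ} {n : Fin d → ℕ} (i : Fin d) (f : ProductSpace n → ℝ≥0∞)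
    (x : ProductSpace n) : ℝ≥0∞ :=
  ballMax (fun y => f (Function.update x i y)) (x i)

lemma measurable_blockMax {d : ℕ} {n : Fin d → ℕ} (i : Fin d) {f : ProductSpace n → ℝ≥0∞}
    (hf : Measurable f) : Measurable (blockMax i f) :=
  measurable_ballMax_param (measurable_pi_apply i)
    (F := fun (x : ProductSpace n) y => f (Function.update x i y)) (hf.comp measurable_update')

lemma lintegral_blockMax_sq_le {d : ℕ} {n : Fin d → ℕ} (i : Fin d) {f : ProductSpace n → ℝ≥0∞}
    (hf : Measurable f) :
    ∫⁻ x, blockMax i f x ^ 2 ≤ ENNReal.ofReal (16 * 5 ^ n i) * ∫⁻ x, f x ^ 2 := by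
  rw [← lintegral_const_mul _ (hf.pow_const 2), volume_pi]
  refine lintegral_le_of_lmarginal_le {i} ((measurable_blockMax i hf).pow_const 2)
    ((hf.pow_const 2).const_mul _) fun x => ?_
  have hx : Measurable fun y => f (Function.update x i y) := hf.comp (measurable_update x)
  simp only [lmarginal_singleton, blockMax, Function.update_self, Function.update_idem]
  rw [lintegral_const_mul _ (hx.pow_const 2)]
  exact lintegral_ballMax_sq_le hx

/-- `T` is a countably sublinear operator, bounded on `L²`, that dominates (up to the factor `K`)
averages over cubes in the blocks of variables indexed by `s`. -/
structure IsMaximalMajorant {d : ℕ} {n : Fin d → ℕ} (s : Finset (Fin d))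
    (T : (ProductSpace n → ℝ≥0∞) → ProductSpace n → ℝ≥0∞) (B K : ℝ) : Prop where
  measurable : ∀ f, Measurable f → Measurable (T f)
  tsum_le : ∀ (c : ℕ → ℝ≥0∞) (f : ℕ → ProductSpace n → ℝ≥0∞), (∀ k, Measurable (f k)) →
    ∀ x, T (fun y => ∑' k, c k * f k y) x ≤ ∑' k, c k * T (f k) x
  lintegral_sq_le : ∀ f, Measurable f →
    ∫⁻ x, T f x ^ 2 ≤ ENNReal.ofReal B * ∫⁻ x, f x ^ 2
  lmarginal_le : ∀ f, Measurable f → ∀ (R : Rect n) (x : ProductSpace n),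
    (∀ i ∈ s, x i ∈ cubeSet (R i)) →
    (∫⋯∫⁻_s, f ∂fun i => volume.restrict (cubeSet (R i))) x ≤
      ENNReal.ofReal K * (∏ i ∈ s, volume (cubeSet (R i))) * T f x

lemma exists_isMaximalMajorant {d : ℕ} (n : Fin d → ℕ) (s : Finset (Fin d)) :
    ∃ (T : (ProductSpace n → ℝ≥0∞) → ProductSpace n → ℝ≥0∞) (B K : ℝ), 1 ≤ B ∧ 1 ≤ K ∧
      IsMaximalMajorant s T B K := by
  induction s using Finset.induction with
  | empty => exact ⟨id, 1, 1, le_rfl, le_rfl, fun _ h => h, fun _ _ _ _ => le_rfl,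
      fun f _ => by simp, fun f _ R x _ => by simp⟩
  | insert i s hi ih =>
    obtain ⟨T, B, K, hB, hK, hT⟩ := ih
    have h5 : (1 : ℝ) ≤ 5 ^ n i := one_le_pow₀ (by norm_num)
    have h4 : (1 : ℝ) ≤ 4 ^ n i := one_le_pow₀ (by norm_num)
    refine ⟨fun f => blockMax i (T f), 16 * 5 ^ n i * B, 4 ^ n i * K, by nlinarith, by nlinarith,
      fun f hf => measurable_blockMax i (hT.measurable f hf), fun c f hf x => ?_, fun f hf => ?_,
      fun f hf R x hx => ?_⟩
    · refine (ballMax_mono (fun y => hT.tsum_le c f hf _) (x i)).trans ?_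
      exact ballMax_tsum_le c
        (fun k => (hT.measurable _ (hf k)).comp (measurable_update x)) (x i)
    · rw [ENNReal.ofReal_mul (by positivity), mul_assoc]
      exact (lintegral_blockMax_sq_le i (hT.measurable f hf)).trans
        (mul_le_mul_right (hT.lintegral_sq_le f hf) _)
    · rw [lmarginal_insert _ hf hi, Finset.prod_insert hi, ENNReal.ofReal_mul (by positivity)]
      set P := ∏ j ∈ s, volume (cubeSet (R j))
      calc _ ≤ ∫⁻ y in cubeSet (R i), ENNReal.ofReal K * P * T f (Function.update x i y) := by
            refine setLIntegral_mono' (measurableSet_cubeSet _) fun y _ => ?_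
            refine hT.lmarginal_le f hf R _ fun j hj => ?_
            rw [Function.update_of_ne (by rintro rfl; exact hi hj)]
            exact hx j (Finset.mem_insert_of_mem hj)
        _ = ENNReal.ofReal K * P * ∫⁻ y in cubeSet (R i), T f (Function.update x i y) :=
            lintegral_const_mul _ ((hT.measurable f hf).comp (measurable_update x))
        _ ≤ ENNReal.ofReal K * P * (ENNReal.ofReal (4 ^ n i) * volume (cubeSet (R i)) *
              blockMax i (T f) x) := by
            gcongr
            exact setLIntegral_cubeSet_le _ _ (hx i (Finset.mem_insert_self i s))
        _ = _ := by ring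

lemma volume_rectSet {d : ℕ} {n : Fin d → ℕ} (R : Rect n) :
    volume (rectSet R) = ∏ i, volume (cubeSet (R i)) := by
  have : rectSet R = Set.univ.pi fun i => cubeSet (R i) := by ext; simp [rectSet]
  rw [this, volume_pi_pi]

lemma volume_rectSet_ne_zero {d : ℕ} {n : Fin d → ℕ} (R : Rect n) : volume (rectSet R) ≠ 0 := by
  rw [volume_rectSet, Finset.prod_ne_zero_iff]
  intro i _
  rw [volume_cubeSet]
  have := (R i).side_pos
  exact (ENNReal.ofReal_pos.2 (by positivity)).ne'

lemma volume_rectSet_ne_top {d : ℕ} {n : Fin d → ℕ} (R : Rect n) : volume (rectSet R) ≠ ⊤ := by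
  rw [volume_rectSet]
  refine ENNReal.prod_ne_top fun i _ => ?_
  rw [volume_cubeSet]
  exact ENNReal.ofReal_ne_top

lemma IsMaximalMajorant.setLIntegral_le {d : ℕ} {n : Fin d → ℕ}
    {T : (ProductSpace n → ℝ≥0∞) → ProductSpace n → ℝ≥0∞} {B K : ℝ}
    (hT : IsMaximalMajorant Finset.univ T B K) {f : ProductSpace n → ℝ≥0∞} (hf : Measurable f)
    (R : Rect n) {x : ProductSpace n} (hx : x ∈ rectSet R) :
    ∫⁻ y in rectSet R, f y ≤ ENNReal.ofReal K * volume (rectSet R) * T f x := by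
  have h := hT.lmarginal_le f hf R x fun i _ => hx i
  have hR : rectSet R = Set.univ.pi fun i => cubeSet (R i) := by ext; simp [rectSet]
  rw [lmarginal_univ, ← volume_rectSet] at h
  rwa [hR, volume_pi, Measure.restrict_pi_pi, ← volume_pi, ← hR]

lemma tsum_two_pow_mul_sq_le (b : ℕ → ℝ≥0∞) :
    (∑' k, 2⁻¹ ^ k * b k) ^ 2 ≤ 4 * ∑' k, 2⁻¹ ^ k * b k ^ 2 := by
  have hprod : ∀ a b : ℝ≥0∞, a * b ≤ a ^ 2 + b ^ 2 := fun a b => by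
    rcases le_total a b with h | h
    · calc a * b ≤ b * b := by gcongr
        _ ≤ _ := by rw [← sq]; exact le_add_self
    · calc a * b ≤ a * a := by gcongr
        _ ≤ _ := by rw [← sq]; exact le_self_add
  have hw : ∑' k : ℕ, (2⁻¹ : ℝ≥0∞) ^ k = 2 := by
    rw [ENNReal.tsum_geometric, ENNReal.one_sub_inv_two, inv_inv]
  set S := ∑' k, (2⁻¹ : ℝ≥0∞) ^ k * b k ^ 2
  calc (∑' k, 2⁻¹ ^ k * b k) ^ 2
      = ∑' k, ∑' l, (2⁻¹ : ℝ≥0∞) ^ k * 2⁻¹ ^ l * (b k * b l) := by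
        rw [sq, ← ENNReal.tsum_mul_right]
        refine tsum_congr fun k => ?_
        rw [← ENNReal.tsum_mul_left]
        exact tsum_congr fun l => by ring
    _ ≤ ∑' k, ∑' l, (2⁻¹ : ℝ≥0∞) ^ k * 2⁻¹ ^ l * (b k ^ 2 + b l ^ 2) := by
        gcongr
        exact hprod _ _
    _ = ∑' k, (2⁻¹ ^ k * b k ^ 2 * 2 + 2⁻¹ ^ k * S) := by
        refine tsum_congr fun k => ?_
        rw [show (2⁻¹ : ℝ≥0∞) ^ k * b k ^ 2 * 2 =
            2⁻¹ ^ k * b k ^ 2 * ∑' l : ℕ, (2⁻¹ : ℝ≥0∞) ^ l by rw [hw],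
          ← ENNReal.tsum_mul_left, ← ENNReal.tsum_mul_left, ← ENNReal.tsum_add]
        exact tsum_congr fun l => by ring
    _ = 4 * S := by
        rw [ENNReal.tsum_add, ENNReal.tsum_mul_right, ENNReal.tsum_mul_right, hw]
        ring

/-- A set of positive measure meets some rectangle around `x` in positive measure. -/
lemma exists_rect_pos {d : ℕ} {n : Fin d → ℕ} {E : Set (ProductSpace n)} (hE : 0 < volume E)
    (x : ProductSpace n) : ∃ R : Rect n, x ∈ rectSet R ∧ volume (E ∩ rectSet R) ≠ 0 := by
  let R : ℕ → Rect n := fun N i => ⟨fun j => x i j - (N + 1), 2 * (N + 1), by positivity⟩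
  have hcov : E ⊆ ⋃ N, E ∩ rectSet (R N) := fun y hy => by
    obtain ⟨N, hN⟩ := exists_nat_gt (dist y x)
    refine Set.mem_iUnion.2 ⟨N, hy, fun i j => ?_⟩
    have h := ((dist_le_pi_dist (y i) (x i) j).trans (dist_le_pi_dist y x i)).trans hN.le
    rw [Real.dist_eq, abs_le] at h
    constructor <;> simp only [R] <;> linarith [h.1, h.2]
  by_contra! hcon
  refine hE.ne' (measure_mono_null hcov (measure_iUnion_null fun N => hcon (R N) fun i j => ?_))
  have : (0 : ℝ) ≤ N := N.cast_nonneg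
  constructor <;> simp only [R] <;> linarith

lemma IsMaximalMajorant.indicator_pos {d : ℕ} {n : Fin d → ℕ}
    {T : (ProductSpace n → ℝ≥0∞) → ProductSpace n → ℝ≥0∞} {B K : ℝ}
    (hT : IsMaximalMajorant Finset.univ T B K) {E : Set (ProductSpace n)}
    (hEm : MeasurableSet E) (hE : 0 < volume E) (x : ProductSpace n) :
    T (E.indicator 1) x ≠ 0 := by
  obtain ⟨R, hx, hR⟩ := exists_rect_pos hE x
  intro h0
  have h := hT.setLIntegral_le (f := E.indicator 1) (measurable_one.indicator hEm) R hx
  rw [h0, mul_zero, lintegral_indicator_one hEm, Measure.restrict_apply hEm] at h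
  exact hR (le_antisymm h zero_le)

/-- The Rubio de Francia algorithm: an indicator function has a majorant `w` with
`T w ≤ 2 * B * w` and controlled `L²` norm. -/
lemma IsMaximalMajorant.exists_weight {d : ℕ} {n : Fin d → ℕ}
    {T : (ProductSpace n → ℝ≥0∞) → ProductSpace n → ℝ≥0∞} {B K : ℝ} (hB : 1 ≤ B)
    (hT : IsMaximalMajorant Finset.univ T B K) {E : Set (ProductSpace n)}
    (hEm : MeasurableSet E) (hE : 0 < volume E) :
    ∃ w : ProductSpace n → ℝ≥0∞, Measurable w ∧ (∀ x, 0 < w x) ∧ (∀ x ∈ E, 1 ≤ w x) ∧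
      ∫⁻ x, w x ^ 2 ≤ 8 * volume E ∧ ∀ x, T w x ≤ 2 * ENNReal.ofReal B * w x := by
  set β := ENNReal.ofReal B with hβ
  have hβ1 : 1 ≤ β := by simpa [hβ] using ENNReal.ofReal_le_ofReal hB
  have hβ0 : β ≠ 0 := (zero_lt_one.trans_le hβ1).ne'
  have hβt : β ≠ ⊤ := ENNReal.ofReal_ne_top
  let F : ℕ → ProductSpace n → ℝ≥0∞ := fun k => T^[k] (E.indicator 1)
  have hFs : ∀ k, F (k + 1) = T (F k) := fun k => Function.iterate_succ_apply' _ _ _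
  have hFm : ∀ k, Measurable (F k) := fun k => by
    induction k with
    | zero => exact measurable_one.indicator hEm
    | succ k ih => rw [hFs]; exact hT.measurable _ ih
  have hF2 : ∀ k, ∫⁻ x, F k x ^ 2 ≤ β ^ k * volume E := fun k => by
    induction k with
    | zero =>
      have : ∀ x, F 0 x ^ 2 = E.indicator 1 x := fun x => by
        by_cases hx : x ∈ E <;> simp [F, hx]
      simp_rw [this]
      rw [lintegral_indicator_one hEm, pow_zero, one_mul]
    | succ k ih =>
      rw [hFs, pow_succ', mul_assoc]
      exact (hT.lintegral_sq_le _ (hFm k)).trans (mul_le_mul_right ih _)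
  have hG : ∀ k, ∫⁻ x, (β⁻¹ ^ k * F k x) ^ 2 ≤ volume E := fun k => by
    simp_rw [mul_pow]
    rw [lintegral_const_mul _ ((hFm k).pow_const 2)]
    calc (β⁻¹ ^ k) ^ 2 * ∫⁻ x, F k x ^ 2 ≤ (β⁻¹ ^ k) ^ 2 * (β ^ k * volume E) := by
          gcongr
          exact hF2 k
      _ = β⁻¹ ^ k * ((β⁻¹ * β) ^ k * volume E) := by ring
      _ ≤ volume E := by
          rw [ENNReal.inv_mul_cancel hβ0 hβt, one_pow, one_mul]
          exact mul_le_of_le_one_left' (pow_le_one₀ zero_le (ENNReal.inv_le_one.2 hβ1))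
  let c : ℕ → ℝ≥0∞ := fun k => 2⁻¹ ^ k * β⁻¹ ^ k
  have hc0 : ∀ k, c k ≠ 0 := fun k =>
    mul_ne_zero (pow_ne_zero _ (by simp)) (pow_ne_zero _ (ENNReal.inv_ne_zero.2 hβt))
  have hcs : ∀ k, c k = 2 * β * c (k + 1) := fun k => by
    calc c k = (2 * 2⁻¹) * (β * β⁻¹) * c k := by
          rw [ENNReal.mul_inv_cancel hβ0 hβt, ENNReal.mul_inv_cancel (by simp) (by simp),
            one_mul, one_mul]
      _ = 2 * β * c (k + 1) := by simp only [c]; ring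
  refine ⟨fun x => ∑' k, c k * F k x, Measurable.tsum fun k => (hFm k).const_mul _,
    fun x => ?_, fun x hx => ?_, ?_, fun x => ?_⟩
  · refine lt_of_lt_of_le ?_ (ENNReal.le_tsum 1)
    exact pos_iff_ne_zero.2 (mul_ne_zero (hc0 1) (hT.indicator_pos hEm hE x))
  · refine le_trans ?_ (ENNReal.le_tsum 0)
    simp [c, F, hx]
  · calc ∫⁻ x, (∑' k, c k * F k x) ^ 2
        ≤ ∫⁻ x, 4 * ∑' k, 2⁻¹ ^ k * (β⁻¹ ^ k * F k x) ^ 2 := by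
          refine lintegral_mono fun x => ?_
          simp only [c, mul_assoc]
          exact tsum_two_pow_mul_sq_le fun k => β⁻¹ ^ k * F k x
      _ = 4 * ∑' k, 2⁻¹ ^ k * ∫⁻ x, (β⁻¹ ^ k * F k x) ^ 2 := by
          have hm : ∀ k, Measurable fun x => (β⁻¹ ^ k * F k x) ^ 2 := fun k =>
            ((hFm k).const_mul _).pow_const 2
          rw [lintegral_const_mul' _ _ (by simp),
            lintegral_tsum fun k => ((hm k).const_mul _).aemeasurable]
          congr 1
          exact tsum_congr fun k => lintegral_const_mul _ (hm k)
      _ ≤ 4 * ∑' k : ℕ, 2⁻¹ ^ k * volume E := by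
          gcongr with k
          exact hG k
      _ = 8 * volume E := by
          rw [ENNReal.tsum_mul_right, ENNReal.tsum_geometric, ENNReal.one_sub_inv_two, inv_inv]
          ring
  · calc T (fun x => ∑' k, c k * F k x) x ≤ ∑' k, c k * T (F k) x := hT.tsum_le c F hFm x
      _ = 2 * β * ∑' k, c (k + 1) * F (k + 1) x := by
          rw [← ENNReal.tsum_mul_left]
          refine tsum_congr fun k => ?_
          rw [hcs k, hFs, mul_assoc]
      _ ≤ 2 * β * ∑' k, c k * F k x :=
          mul_le_mul_right (ENNReal.tsum_comp_le_tsum_of_injective (add_left_injective 1)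
            (fun k => c k * F k x)) _

/-- there are `C, A > 0` (depending only on the dimensions) such that
every measurable `E` with `0 < |E| < ∞` admits a strong-maximal `A₁` weight
`m : ℝⁿ → (0,1]` with `m = 1` a.e. on `E`, `‖m‖_{L²} ≤ C|E|^{1/2}` and
`M_s m ≤ A·m` a.e. -/
theorem statement9 {d : ℕ} (hd : 1 ≤ d) (n : Fin d → ℕ) (hn : ∀ i, 1 ≤ n i) :
    ∃ C > (0 : ℝ), ∃ A > (0 : ℝ),
      ∀ E : Set (ProductSpace n), MeasurableSet E → 0 < volume E → volume E < ⊤ →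
        ∃ m : ProductSpace n → ℝ,
          Measurable m ∧ (∀ x, 0 < m x ∧ m x ≤ 1) ∧
          (∀ᵐ x ∂(volume : Measure (ProductSpace n)), x ∈ E → m x = 1) ∧
          (∫⁻ x, ENNReal.ofReal (m x ^ 2)) ^ (1 / 2 : ℝ) ≤
            ENNReal.ofReal C * volume E ^ (1 / 2 : ℝ) ∧
          (∀ᵐ x ∂(volume : Measure (ProductSpace n)),
            strongMaximal m x ≤ ENNReal.ofReal (A * m x)) := by
  obtain ⟨T, B, K, hB, hK, hT⟩ := exists_isMaximalMajorant n Finset.univ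
  have hA : 1 ≤ 2 * B * K := by nlinarith
  refine ⟨8 ^ (1 / 2 : ℝ), by positivity, 2 * B * K, by positivity, fun E hEm hE _ => ?_⟩
  obtain ⟨w, hwm, hw0, hwE, hw2, hTw⟩ := hT.exists_weight hB hEm hE
  have hmin : ∀ x, ENNReal.ofReal (min (w x) 1).toReal = min (w x) 1 := fun x =>
    ENNReal.ofReal_toReal (ne_top_of_le_ne_top ENNReal.one_ne_top (min_le_right _ _))
  refine ⟨fun x => (min (w x) 1).toReal, (hwm.min measurable_const).ennreal_toReal,
    fun x => ⟨?_, ?_⟩, Eventually.of_forall fun x hx => ?_, ?_, Eventually.of_forall fun x => ?_⟩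
  · exact ENNReal.toReal_pos (lt_min (hw0 x) zero_lt_one).ne'
      (ne_top_of_le_ne_top ENNReal.one_ne_top (min_le_right _ _))
  · exact ENNReal.toReal_le_of_le_ofReal zero_le_one (by simp)
  · simp [min_eq_right (hwE x hx)]
  · rw [← ENNReal.ofReal_rpow_of_pos (by norm_num), ← ENNReal.mul_rpow_of_nonneg _ _ (by norm_num)]
    refine ENNReal.rpow_le_rpow (le_trans (lintegral_mono fun x => ?_)
      (hw2.trans (by norm_num))) (by norm_num)
    rw [ENNReal.ofReal_pow ENNReal.toReal_nonneg, hmin]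
    gcongr
    exact min_le_left _ _
  · rw [ENNReal.ofReal_mul (by positivity), hmin]
    refine iSup₂_le fun R hx => ?_
    simp_rw [abs_of_nonneg ENNReal.toReal_nonneg, hmin]
    have h0 := volume_rectSet_ne_zero R
    have h1 := volume_rectSet_ne_top R
    rw [← ENNReal.div_eq_inv_mul, ENNReal.div_le_iff h0 h1]
    rcases le_total (w x) 1 with h | h
    · rw [min_eq_left h]
      calc ∫⁻ y in rectSet R, min (w y) 1 ≤ ∫⁻ y in rectSet R, w y :=
            lintegral_mono fun y => min_le_left _ _
        _ ≤ ENNReal.ofReal K * volume (rectSet R) * T w x := hT.setLIntegral_le hwm R hx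
        _ ≤ ENNReal.ofReal K * volume (rectSet R) * (2 * ENNReal.ofReal B * w x) := by
            gcongr
            exact hTw x
        _ = _ := by
            rw [ENNReal.ofReal_mul (by positivity), ENNReal.ofReal_mul (by norm_num),
              ENNReal.ofReal_ofNat]
            ring
    · rw [min_eq_right h, mul_one]
      calc ∫⁻ y in rectSet R, min (w y) 1 ≤ ∫⁻ y in rectSet R, 1 :=
            lintegral_mono fun y => min_le_right _ _
        _ = 1 * volume (rectSet R) := by rw [setLIntegral_one, one_mul]
        _ ≤ _ := by
            gcongr
            simpa using ENNReal.ofReal_le_ofReal hA
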